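/- arXiv:2302.00743 — 6 statements merged into one kernel-verified Lean document; each statement's English description precedes it below -/
import Mathlib

section
/- Let ⊏ be a transitive and irreflexive relation on a set W, and equip W with the topology τ_⊏ whose open sets are exactly the ⊏-upward-closed subsets of W (U is open iff whenever x ∈ U and x ⊏ y, then y ∈ U). Then the space ⟨W, τ_⊏⟩ is scattered if and only if ⊏ is converse well-founded, i.e. the converse relation ⊐ is well-founded. -/
/-- The Cantor derivative: the set of points `x` lying in the closure of `A \ {x}`. -/
def dSet {X : Type*} [TopologicalSpace X] (A : Set X) : Set X :=
  {x | x ∈ closure (A \ {x})}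

/-- A topological space is scattered if every set contained in its Cantor derivative is empty. -/
def Scattered (X : Type*) [TopologicalSpace X] : Prop :=
  ∀ S : Set X, S ⊆ dSet S → S = ∅

/-- The topology on `W` whose open sets are exactly the `r`-upward-closed sets. -/
def upsetTopology {W : Type*} (r : W → W → Prop) : TopologicalSpace W where
  IsOpen U := ∀ x ∈ U, ∀ y, r x y → y ∈ U
  isOpen_univ := fun _ _ _ _ => trivial
  isOpen_inter := fun _ _ hU hV x hx y hr => ⟨hU x hx.1 y hr, hV x hx.2 y hr⟩
  isOpen_sUnion := fun S hS x hx y hr => by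
    obtain ⟨U, hU, hxU⟩ := hx
    exact ⟨U, hU, hS U hU x hxU y hr⟩

theorem mem_dSet_upset {W : Type*} (r : W → W → Prop)
    (htrans : ∀ x y z, r x y → r y z → r x z) (hirr : ∀ x, ¬ r x x) (A : Set W) (x : W) :
    x ∈ @dSet W (upsetTopology r) A ↔ ∃ y ∈ A, r x y := by
  letI := upsetTopology r
  change x ∈ closure (A \ {x}) ↔ _
  rw [mem_closure_iff]
  constructor
  · intro h
    have ho : IsOpen {y | y = x ∨ r x y} := by
      change ∀ a ∈ {y | y = x ∨ r x y}, ∀ b, r a b → b ∈ {y | y = x ∨ r x y}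
      rintro a (rfl | ha) b hb
      · exact Or.inr hb
      · exact Or.inr (htrans _ _ _ ha hb)
    obtain ⟨y, hy, hyA, hne⟩ := h _ ho (Or.inl rfl)
    rcases hy with hy | hy
    · exact absurd hy hne
    · exact ⟨y, hyA, hy⟩
  · rintro ⟨y, hyA, hxy⟩ o ho hxo
    refine ⟨y, ?_, hyA, ?_⟩
    · exact (show ∀ a ∈ o, ∀ b, r a b → b ∈ o from ho) x hxo y hxy
    · rintro rfl
      exact hirr _ hxy

theorem scattered_iff_converse_wellFounded {W : Type*} (r : W → W → Prop)
    (htrans : Transitive r) (hirr : Irreflexive r) :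
    (@Scattered W (upsetTopology r)) ↔ WellFounded (fun x y => r y x) := by
  have key := mem_dSet_upset r (fun _ _ _ h1 h2 => htrans h1 h2) (fun x => hirr x)
  constructor
  · intro h
    rw [WellFounded.wellFounded_iff_has_min]
    intro s hs
    by_contra hcon
    push Not at hcon
    refine hs.ne_empty (h s ?_)
    intro x hx
    exact (key s x).2 (hcon x hx)
  · intro hwf S hS
    by_contra hne
    obtain ⟨m, hm, hmin⟩ := hwf.has_min S (Set.nonempty_iff_ne_empty.2 hne)
    obtain ⟨y, hy, hmy⟩ := (key S m).1 (hS hm)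
    exact hmin y hy hmy
end

section
/- Let R be a weakly transitive relation on a set W (i.e. x R y and y R z imply x R z or x = z), and equip W with the topology whose open sets are exactly the R-upward-closed subsets of W. Then for every A ⊆ W, the Cantor derivative of A in this topology is d(A) = { x ∈ W : there exists y ∈ A with y ≠ x and x R y }. -/
theorem dSet_eq_relational_diamond {W : Type*} (R : W → W → Prop)
    (hwt : ∀ x y z, R x y → R y z → R x z ∨ x = z) (A : Set W) :
    @dSet W (upsetTopology R) A = {x | ∃ y ∈ A, y ≠ x ∧ R x y} := by
  letI := upsetTopology R
  ext x
  change x ∈ closure (A \ {x}) ↔ ∃ y ∈ A, y ≠ x ∧ R x y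
  rw [mem_closure_iff]
  constructor
  · intro h
    have ho : IsOpen {y | x = y ∨ R x y} := by
      change ∀ a ∈ {y | x = y ∨ R x y}, ∀ b, R a b → b ∈ {y | x = y ∨ R x y}
      rintro a (rfl | ha) b hb
      · exact Or.inr hb
      · exact (hwt x a b ha hb).symm
    obtain ⟨y, hy, hyA, hyx⟩ := h _ ho (Or.inl rfl)
    have hne : y ≠ x := hyx
    rcases hy with hy | hy
    · exact absurd hy.symm hne
    · exact ⟨y, hyA, hne, hy⟩
  · rintro ⟨y, hyA, hne, hr⟩ U hU hx
    have hU2 : ∀ a ∈ U, ∀ b, R a b → b ∈ U := hU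
    exact ⟨y, hU2 x hx y hr, hyA, hne⟩
end

section
/- A topological space X is a T_D space, meaning that for every point x ∈ X the singleton {x} is the intersection of an open set and a closed set, if and only if for every subset A ⊆ X it holds that d(d(A)) ⊆ d(A), where d denotes the Cantor derivative. (This is the semantic content of the correspondence between the axiom 4 := □φ → □□φ and T_D spaces in d-semantics.) -/
theorem TD_iff_dSet_idempotent {X : Type*} [TopologicalSpace X] :
    (∀ x : X, ∃ U C : Set X, IsOpen U ∧ IsClosed C ∧ ({x} : Set X) = U ∩ C) ↔
      (∀ A : Set X, dSet (dSet A) ⊆ dSet A) := by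
  constructor
  · intro h A x hx
    obtain ⟨U, C, hU, hC, hxUC⟩ := h x
    have hxm : x ∈ U ∩ C := hxUC ▸ Set.mem_singleton x
    change x ∈ closure (A \ {x})
    rw [mem_closure_iff]
    intro V hV hxV
    have hx' : x ∈ closure (dSet A \ {x}) := hx
    obtain ⟨y, ⟨hyV, hyU⟩, hyd, hyx⟩ :=
      mem_closure_iff.1 hx' (V ∩ U) (hV.inter hU) ⟨hxV, hxm.1⟩
    have hyC : y ∉ C := fun hc => hyx (by rw [hxUC]; exact ⟨hyU, hc⟩)
    have hyd' : y ∈ closure (A \ {y}) := hyd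
    obtain ⟨z, ⟨hzV, hzC⟩, hzA, _⟩ :=
      mem_closure_iff.1 hyd' (V ∩ Cᶜ) (hV.inter hC.isOpen_compl) ⟨hyV, hyC⟩
    refine ⟨z, hzV, hzA, ?_⟩
    intro hzx
    rw [Set.mem_singleton_iff] at hzx
    subst hzx
    exact hzC hxm.2
  · intro h x
    have h1 : x ∉ dSet ({x} : Set X) := by simp [dSet]
    have h2 : x ∉ closure (dSet ({x} : Set X) \ {x}) := fun hx => h1 (h {x} hx)
    refine ⟨(closure (dSet ({x} : Set X) \ {x}))ᶜ, closure {x},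
      isClosed_closure.isOpen_compl, isClosed_closure, ?_⟩
    apply Set.Subset.antisymm
    · intro y hy
      rw [Set.mem_singleton_iff] at hy
      subst hy
      exact ⟨h2, subset_closure rfl⟩
    · rintro y ⟨hy1, hy2⟩
      by_contra hyx
      apply hy1
      apply subset_closure
      refine ⟨?_, hyx⟩
      change y ∈ closure ({x} \ {y})
      rwa [Set.sdiff_singleton_eq_self hyx]
end

section
/- A topological space X is scattered if and only if for every subset A ⊆ X it holds that d(A) ⊆ d(A \ d(A)), where d denotes the Cantor derivative. (This is the semantic content of the Simmons–Esakia theorem that the Löb axiom L := □(□φ → φ) → □φ is d-valid exactly on scattered spaces.) -/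
theorem scattered_iff_loeb {X : Type*} [TopologicalSpace X] :
    Scattered X ↔ ∀ A : Set X, dSet A ⊆ dSet (A \ dSet A) := by
  constructor
  · intro h A x hx
    by_contra hn
    have hn' : ¬ x ∈ closure ((A \ dSet A) \ {x}) := hn
    rw [mem_closure_iff] at hn'
    push Not at hn'
    obtain ⟨U, hU, hxU, hUe⟩ := hn'
    have key : ∀ y ∈ U, y ∈ dSet A → y ∈ dSet (A ∩ U ∪ {x}) := by
      intro y hyU hy
      change y ∈ closure _
      have hy' : y ∈ closure (A \ {y}) := hy
      rw [mem_closure_iff] at hy' ⊢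
      intro V hV hyV
      obtain ⟨z, hz, hzA, hzy⟩ := hy' (V ∩ U) (hV.inter hU) ⟨hyV, hyU⟩
      exact ⟨z, hz.1, Or.inl ⟨hzA, hz.2⟩, hzy⟩
    have hS := h (A ∩ U ∪ {x}) (by
      rintro y (⟨hyA, hyU⟩ | hy)
      · apply key y hyU
        by_contra hyd
        by_cases hyx : y = x
        · exact hyd (hyx ▸ hx)
        · have hmem : y ∈ U ∩ ((A \ dSet A) \ {x}) := ⟨hyU, ⟨hyA, hyd⟩, hyx⟩
          rw [hUe] at hmem
          exact hmem
      · have hyx : y = x := hy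
        subst hyx
        exact key y hxU hx)
    have hxS : x ∈ A ∩ U ∪ {x} := Or.inr rfl
    rw [hS] at hxS
    exact hxS
  · intro h S hS
    have h1 := h S
    rw [Set.diff_eq_empty.mpr hS] at h1
    rw [Set.eq_empty_iff_forall_notMem]
    intro x hx
    have h2 := h1 (hS hx)
    simp [dSet] at h2
end

section
/- Let X be a topological space and f : X → X a function. Then f is continuous if and only if for every subset A ⊆ X it holds that d(f⁻¹(A)) ⊆ f⁻¹(A) ∪ f⁻¹(d(A)), where d denotes the Cantor derivative. (This is the semantic content of the correspondence between continuity of f and the axiom C := ●φ ∧ ●□φ → □●φ in d-semantics.) -/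
theorem continuous_iff_dSet_preimage {X : Type*} [TopologicalSpace X] (f : X → X) :
    Continuous f ↔
      ∀ A : Set X, dSet (f ⁻¹' A) ⊆ f ⁻¹' A ∪ f ⁻¹' (dSet A) := by
  constructor
  · intro hf A x hx
    by_cases h : f x ∈ A
    · exact Or.inl h
    · right
      have h1 : x ∈ closure (f ⁻¹' A) := closure_mono Set.diff_subset hx
      have h2 : f x ∈ closure A := hf.closure_preimage_subset A h1
      change f x ∈ closure (A \ {f x})
      rwa [Set.diff_singleton_eq_self h]
  · intro H
    rw [continuous_iff_isClosed]
    intro s hs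
    apply isClosed_of_closure_subset
    intro x hx
    by_contra h
    have hd : x ∈ dSet (f ⁻¹' s) := by
      change x ∈ closure (f ⁻¹' s \ {x})
      rwa [Set.diff_singleton_eq_self h]
    rcases H s hd with h1 | h1
    · exact h h1
    · have h2 : f x ∈ closure s := closure_mono Set.diff_subset h1
      rw [hs.closure_eq] at h2
      exact h h2
end

section
/- Let X be a topological space and f : X → X a bijection. Then f is a homeomorphism if and only if for every subset A ⊆ X it holds that d(f⁻¹(A)) = f⁻¹(d(A)), where d denotes the Cantor derivative. (This is the semantic content of the correspondence between f being a homeomorphism and the axiom H := □●φ ↔ ●□φ in d-semantics.) -/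
theorem isClosed_iff_dSet_subset {X : Type*} [TopologicalSpace X] (A : Set X) :
    IsClosed A ↔ dSet A ⊆ A := by
  constructor
  · intro h x hx
    exact h.closure_subset (closure_mono Set.sdiff_subset hx)
  · intro h
    refine isClosed_of_closure_subset fun x hx => ?_
    by_contra hxA
    apply hxA
    apply h
    change x ∈ closure (A \ {x})
    rwa [Set.diff_singleton_eq_self hxA]

theorem isHomeomorph_iff_dSet_preimage {X : Type*} [TopologicalSpace X] (f : X → X)
    (hf : Function.Bijective f) :
    IsHomeomorph f ↔ ∀ A : Set X, dSet (f ⁻¹' A) = f ⁻¹' (dSet A) := by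
  constructor
  · intro h A
    ext x
    have hx : f ⁻¹' A \ {x} = f ⁻¹' (A \ {f x}) := by
      ext y
      simp [hf.1.eq_iff]
    change x ∈ closure (f ⁻¹' A \ {x}) ↔ x ∈ f ⁻¹' closure (A \ {f x})
    rw [hx, h.isOpenMap.preimage_closure_eq_closure_preimage h.continuous]
  · intro h
    have key : ∀ A : Set X, IsClosed (f ⁻¹' A) ↔ IsClosed A := fun A => by
      rw [isClosed_iff_dSet_subset, isClosed_iff_dSet_subset, h,
        hf.2.preimage_subset_preimage_iff]
    refine ⟨continuous_iff_isClosed.2 fun A hA => (key A).2 hA, fun U hU => ?_, hf⟩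
    rw [← isClosed_compl_iff, ← key, Set.preimage_compl, Set.preimage_image_eq _ hf.1]
    exact hU.isClosed_compl
end
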